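/- arXiv:2509.19043 — 2 statements merged into one kernel-verified Lean document; each statement's English description precedes it below -/
import Mathlib

section
/- Let d ≥ 1, T > 0, ε > 0, and let 𝔤 ∈ C¹(ℝ^d × ℝ; ℝ^d). Let u : (0,T) × ℝ^d → ℝ be a bounded C² classical solution of ∂_t u + div_x ( 𝔤(x, u(t,x)) ) = ε Δ_x u on (0,T) × ℝ^d. Then for every constant λ ∈ ℝ and every nonnegative φ ∈ C_c^∞((0,T) × ℝ^d): ∫₀^T ∫_{ℝ^d} ( |u − λ| ∂_t φ + sgn(u − λ)(𝔤(x,u) − 𝔤(x,λ)) · ∇_x φ − sgn(u − λ) (div_x 𝔤)(x,λ) φ + ε |u − λ| Δ_x φ ) dx dt ≥ 0. -/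
open Set MeasureTheory Function Filter
open scoped RealInnerProductSpace

/-- The classical divergence `Σ_i ∂_{x_i} g_i (x)` of a vector field on `ℝ^d`. -/
noncomputable def divg {d : ℕ} (g : EuclideanSpace ℝ (Fin d) → EuclideanSpace ℝ (Fin d))
    (x : EuclideanSpace ℝ (Fin d)) : ℝ :=
  ∑ i, fderiv ℝ g x (EuclideanSpace.single i 1) i

/-- The classical Laplacian `Σ_i ∂²_{x_i x_i} φ (x)` of a scalar field on `ℝ^d`. -/
noncomputable def lap {d : ℕ} (φ : EuclideanSpace ℝ (Fin d) → ℝ)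
    (x : EuclideanSpace ℝ (Fin d)) : ℝ :=
  ∑ i, fderiv ℝ (fun y => fderiv ℝ φ y (EuclideanSpace.single i 1)) x (EuclideanSpace.single i 1)

noncomputable def eta (δ s : ℝ) : ℝ := Real.sqrt (s ^ 2 + δ ^ 2)
noncomputable def sgnA (δ s : ℝ) : ℝ := s / eta δ s
noncomputable def sgnD (δ s : ℝ) : ℝ := δ ^ 2 / eta δ s ^ 3

lemma eta_pos {δ : ℝ} (hδ : 0 < δ) (s : ℝ) : 0 < eta δ s := by
  unfold eta; positivity

lemma eta_sq (δ s : ℝ) : eta δ s ^ 2 = s ^ 2 + δ ^ 2 := by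
  unfold eta; rw [Real.sq_sqrt]; positivity

lemma abs_le_eta (δ s : ℝ) : |s| ≤ eta δ s := by
  unfold eta; apply Real.abs_le_sqrt; nlinarith [sq_nonneg δ]

lemma eta_le {δ : ℝ} (hδ : 0 < δ) (h1 : δ ≤ 1) (s : ℝ) : eta δ s ≤ |s| + 1 := by
  unfold eta
  rw [Real.sqrt_le_left (by positivity)]
  nlinarith [abs_nonneg s, sq_abs s]

lemma contDiff_eta {δ : ℝ} (hδ : 0 < δ) {n : WithTop ℕ∞} : ContDiff ℝ n (eta δ) := by
  unfold eta
  apply ContDiff.sqrt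
  · fun_prop
  · intro x; positivity

lemma contDiff_sgnA {δ : ℝ} (hδ : 0 < δ) {n : WithTop ℕ∞} : ContDiff ℝ n (sgnA δ) := by
  unfold sgnA
  exact contDiff_id.div (contDiff_eta hδ) (fun x => (eta_pos hδ x).ne')

lemma hasDerivAt_eta {δ : ℝ} (hδ : 0 < δ) (s : ℝ) : HasDerivAt (eta δ) (sgnA δ s) s := by
  have h : HasDerivAt (fun s : ℝ => s ^ 2 + δ ^ 2) (2 * s) s := by
    simpa using (hasDerivAt_pow 2 s).add_const (δ ^ 2)
  have := h.sqrt (by positivity)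
  refine HasDerivAt.congr_deriv (f' := _) this ?_
  unfold sgnA eta
  have : 0 < Real.sqrt (s ^ 2 + δ ^ 2) := by positivity
  field_simp

lemma hasDerivAt_sgnA {δ : ℝ} (hδ : 0 < δ) (s : ℝ) : HasDerivAt (sgnA δ) (sgnD δ s) s := by
  have := (hasDerivAt_id s).div (hasDerivAt_eta hδ s) (eta_pos hδ s).ne'
  refine HasDerivAt.congr_deriv (f' := _) this ?_
  have h := eta_pos hδ s
  have h2 := eta_sq δ s
  simp only [sgnD, sgnA, id]
  field_simp
  linarith

lemma sgnD_nonneg {δ : ℝ} (hδ : 0 < δ) (s : ℝ) : 0 ≤ sgnD δ s := by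
  have := eta_pos hδ s
  unfold sgnD; positivity

lemma continuous_sgnD {δ : ℝ} (hδ : 0 < δ) : Continuous (sgnD δ) := by
  unfold sgnD
  exact continuous_const.div ((contDiff_eta hδ (n := 0)).continuous.pow 3)
    (fun x => (pow_pos (eta_pos hδ x) 3).ne')

lemma abs_sgnA_le {δ : ℝ} (hδ : 0 < δ) (s : ℝ) : |sgnA δ s| ≤ 1 := by
  have := eta_pos hδ s
  unfold sgnA
  rw [abs_div, abs_of_pos this, div_le_one this]
  exact abs_le_eta δ s

lemma abs_mul_sgnD_le {δ : ℝ} (hδ : 0 < δ) (s : ℝ) : |s| * sgnD δ s ≤ 1 := by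
  have h := eta_pos hδ s
  unfold sgnD
  rw [← mul_div_assoc, div_le_one (by positivity)]
  have h1 := abs_le_eta δ s
  have h2 := eta_sq δ s
  have h3 : δ ^ 2 ≤ eta δ s ^ 2 := by nlinarith [sq_nonneg s]
  calc |s| * δ ^ 2 ≤ eta δ s * eta δ s ^ 2 := by gcongr
    _ = _ := by ring

open Topology in
lemma tendsto_eta (s : ℝ) : Tendsto (fun δ => eta δ s) (𝓝 0) (𝓝 |s|) := by
  have : Continuous (fun δ => eta δ s) := by unfold eta; fun_prop
  have h := this.tendsto 0
  simpa [eta, Real.sqrt_sq_eq_abs] using h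

open Topology in
lemma tendsto_sgnA (s : ℝ) : Tendsto (fun δ => sgnA δ s) (𝓝 0) (𝓝 (Real.sign s)) := by
  rcases lt_trichotomy s 0 with h | h | h
  · have := (tendsto_const_nhds (x := s)).div (tendsto_eta s) (abs_pos.2 h.ne).ne'
    rw [Real.sign_of_neg h]
    have e : s / |s| = -1 := by rw [abs_of_neg h, div_neg, div_self h.ne]
    rw [e] at this
    exact this
  · subst h; simp [sgnA]
  · have := (tendsto_const_nhds (x := s)).div (tendsto_eta s) (abs_pos.2 h.ne').ne'
    rw [Real.sign_of_pos h]
    have e : s / |s| = 1 := by rw [abs_of_pos h]; field_simp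
    rw [e] at this
    exact this

open Topology in
lemma tendsto_sgnD {s : ℝ} (hs : s ≠ 0) : Tendsto (fun δ => sgnD δ s) (𝓝 0) (𝓝 0) := by
  have h1 : Tendsto (fun δ : ℝ => δ ^ 2) (𝓝 0) (𝓝 0) := by
    have : Continuous (fun δ : ℝ => δ ^ 2) := by fun_prop
    simpa using this.tendsto 0
  have := h1.div ((tendsto_eta s).pow 3) (by positivity)
  rw [zero_div] at this
  exact this

lemma measurable_sign : Measurable Real.sign := by
  unfold Real.sign
  exact Measurable.ite measurableSet_Iio measurable_const
    (Measurable.ite measurableSet_Ioi measurable_const measurable_const)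

lemma abs_sign_le (s : ℝ) : |Real.sign s| ≤ 1 := by
  rcases Real.sign_apply_eq s with h | h | h <;> simp [h]

section abs
set_option linter.unusedSectionVars false
variable {H : Type*} [NormedAddCommGroup H] [NormedSpace ℝ H] [FiniteDimensional ℝ H]
  [MeasurableSpace H] [BorelSpace H] (μ : Measure H) [μ.IsAddHaarMeasure]

lemma integrable_fderiv_cc {f : H → ℝ} (hf : ContDiff ℝ 1 f) (hc : HasCompactSupport f) (e : H) :
    Integrable (fun q => fderiv ℝ f q e) μ := by
  apply Continuous.integrable_of_hasCompactSupport
  · exact (hf.continuous_fderiv one_ne_zero).clm_apply continuous_const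
  · exact hc.fderiv_apply ℝ e

lemma integral_fderiv_cc {f : H → ℝ} (hf : ContDiff ℝ 1 f) (hc : HasCompactSupport f) (e : H) :
    ∫ q, fderiv ℝ f q e ∂μ = 0 := by
  have := integral_mul_fderiv_eq_neg_fderiv_mul_of_integrable (μ := μ) (f := fun _ : H => (1:ℝ))
    (g := f) (v := e) (by simp) (by simpa using integrable_fderiv_cc μ hf hc e)
    (by simpa using hf.continuous.integrable_of_hasCompactSupport hc)
    (by intros; fun_prop) (fun x _ => (hf.differentiable one_ne_zero) x)
  simpa using this

theorem abstract_entropy {d : ℕ} (v φ K : H → ℝ) (F : Fin d → H → ℝ) (e0 : H) (e : Fin d → H)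
    (ε L : ℝ) (hε : 0 < ε)
    (hv : ContDiff ℝ 2 v) (hφ : ContDiff ℝ 2 φ) (hc : HasCompactSupport φ) (hφ0 : ∀ q, 0 ≤ φ q)
    (hK : Continuous K) (hF : ∀ i, ContDiff ℝ 1 (F i))
    (hL : ∀ q ∈ tsupport φ, ∀ i, |F i q| ≤ L * |v q|)
    (heq : ∀ q ∈ tsupport φ, fderiv ℝ v q e0 + ∑ i, fderiv ℝ (F i) q (e i) + K q
      = ε * ∑ i, fderiv ℝ (fun p => fderiv ℝ v p (e i)) q (e i)) :
    let J := fun q => |v q| * fderiv ℝ φ q e0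
        + Real.sign (v q) * ∑ i, F i q * fderiv ℝ φ q (e i)
        - Real.sign (v q) * K q * φ q
        + ε * |v q| * ∑ i, fderiv ℝ (fun p => fderiv ℝ φ p (e i)) q (e i)
    Integrable J μ ∧ 0 ≤ ∫ q, J q ∂μ := by
  intro J
  have hdv : ∀ i, ContDiff ℝ 1 (fun p => fderiv ℝ v p (e i)) := fun i =>
    (hv.fderiv_right (m := 1) (by norm_num)).clm_apply contDiff_const
  have hdφ : ∀ i, ContDiff ℝ 1 (fun p => fderiv ℝ φ p (e i)) := fun i =>
    (hφ.fderiv_right (m := 1) (by norm_num)).clm_apply contDiff_const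
  have hv1 : ContDiff ℝ 1 v := hv.of_le (by norm_num)
  have hφ1 : ContDiff ℝ 1 φ := hφ.of_le (by norm_num)
  have cv := hv.continuous
  have cφ := hφ.continuous
  have cF : ∀ i, Continuous (F i) := fun i => (hF i).continuous
  have cφ0 : Continuous (fun q => fderiv ℝ φ q e0) :=
    (hφ1.continuous_fderiv one_ne_zero).clm_apply continuous_const
  have cφi : ∀ i, Continuous (fun q => fderiv ℝ φ q (e i)) := fun i => (hdφ i).continuous
  have cvi : ∀ i, Continuous (fun q => fderiv ℝ v q (e i)) := fun i => (hdv i).continuous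
  have cφii : ∀ i, Continuous (fun q => fderiv ℝ (fun p => fderiv ℝ φ p (e i)) q (e i)) :=
    fun i => ((hdφ i).continuous_fderiv one_ne_zero).clm_apply continuous_const
  have hci : ∀ i, HasCompactSupport (fun p => fderiv ℝ φ p (e i)) := fun i => hc.fderiv_apply ℝ _
  -- vanishing off the support
  have z0 : ∀ q, q ∉ tsupport φ → φ q = 0 := fun q hq => image_eq_zero_of_notMem_tsupport hq
  have z1 : ∀ q, q ∉ tsupport φ → fderiv ℝ φ q = 0 := fun q hq =>
    image_eq_zero_of_notMem_tsupport (fun h => hq (tsupport_fderiv_subset ℝ h))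
  have z2 : ∀ q, q ∉ tsupport φ → ∀ i, fderiv ℝ (fun p => fderiv ℝ φ p (e i)) q = 0 := by
    intro q hq i
    apply image_eq_zero_of_notMem_tsupport
    intro h
    exact hq ((tsupport_fderiv_subset ℝ).trans (tsupport_fderiv_apply_subset ℝ (e i)) h)
  -- regularised integrand
  let Jd : ℝ → H → ℝ := fun δ q => eta δ (v q) * fderiv ℝ φ q e0
        + sgnA δ (v q) * ∑ i, F i q * fderiv ℝ φ q (e i)
        - sgnA δ (v q) * K q * φ q
        + ε * eta δ (v q) * ∑ i, fderiv ℝ (fun p => fderiv ℝ φ p (e i)) q (e i)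
        + φ q * ∑ i, (sgnD δ (v q) * F i q) * fderiv ℝ v q (e i)
  let B : H → ℝ := fun q => (|v q| + 1) * |fderiv ℝ φ q e0|
        + |∑ i, F i q * fderiv ℝ φ q (e i)|
        + |K q| * φ q
        + ε * (|v q| + 1) * |∑ i, fderiv ℝ (fun p => fderiv ℝ φ p (e i)) q (e i)|
        + φ q * ∑ i, |L| * |fderiv ℝ v q (e i)|
  have hB : Integrable B μ := by
    apply Continuous.integrable_of_hasCompactSupport
    · fun_prop
    · apply HasCompactSupport.intro hc
      intro q hq
      simp [B, z0 q hq, z1 q hq, z2 q hq]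
  have bound4 : ∀ q (a b c d' : ℝ), |a| ≤ |v q| + 1 → |b| ≤ 1 →
      |a * fderiv ℝ φ q e0 + b * ∑ i, F i q * fderiv ℝ φ q (e i) - b * K q * φ q
        + ε * a * ∑ i, fderiv ℝ (fun p => fderiv ℝ φ p (e i)) q (e i) + φ q * d'|
      ≤ (|v q| + 1) * |fderiv ℝ φ q e0|
        + |∑ i, F i q * fderiv ℝ φ q (e i)|
        + |K q| * φ q
        + ε * (|v q| + 1) * |∑ i, fderiv ℝ (fun p => fderiv ℝ φ p (e i)) q (e i)|
        + φ q * |d'| := by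
    intro q a b c d' ha hb
    generalize fderiv ℝ φ q e0 = x1
    generalize ∑ i, F i q * fderiv ℝ φ q (e i) = x2
    generalize ∑ i, fderiv ℝ (fun p => fderiv ℝ φ p (e i)) q (e i) = x3
    have hq := hφ0 q
    have t1 : |a * x1| ≤ (|v q| + 1) * |x1| := by rw [abs_mul]; gcongr
    have t2 : |b * x2| ≤ |x2| := by
      rw [abs_mul]; exact mul_le_of_le_one_left (abs_nonneg _) hb
    have t3 : |b * K q * φ q| ≤ |K q| * φ q := by
      rw [abs_mul, abs_mul, abs_of_nonneg hq]
      gcongr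
      exact mul_le_of_le_one_left (abs_nonneg _) hb
    have t4 : |ε * a * x3| ≤ ε * (|v q| + 1) * |x3| := by
      rw [abs_mul, abs_mul, abs_of_pos hε]; gcongr
    have t5 : |φ q * d'| = φ q * |d'| := by rw [abs_mul, abs_of_nonneg hq]
    rw [← t5]
    refine (abs_add_le _ _).trans (add_le_add ?_ le_rfl)
    refine (abs_add_le _ _).trans (add_le_add ?_ t4)
    refine (abs_sub _ _).trans (add_le_add ?_ t3)
    exact (abs_add_le _ _).trans (add_le_add t1 t2)
  have hJB : ∀ q, ‖J q‖ ≤ B q := by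
    intro q
    have := bound4 q |v q| (Real.sign (v q)) 0 0 (by rw [abs_abs]; linarith) (abs_sign_le _)
    simp only [mul_zero, add_zero, abs_zero] at this
    rw [Real.norm_eq_abs]
    refine this.trans ?_
    simp only [B]
    have : 0 ≤ φ q * ∑ i, |L| * |fderiv ℝ v q (e i)| :=
      mul_nonneg (hφ0 q) (Finset.sum_nonneg fun i _ => by positivity)
    linarith
  have hJm : Measurable J := by
    have m1 : Measurable (fun q => Real.sign (v q)) := measurable_sign.comp cv.measurable
    have m2 : Measurable (fun q => ∑ i, F i q * fderiv ℝ φ q (e i)) :=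
      Continuous.measurable (by fun_prop)
    have m3 : Measurable (fun q => |v q| * fderiv ℝ φ q e0) :=
      Continuous.measurable (by fun_prop)
    have m4 : Measurable (fun q => ε * |v q| * ∑ i, fderiv ℝ (fun p => fderiv ℝ φ p (e i)) q (e i)) :=
      Continuous.measurable (by fun_prop)
    exact ((m3.add (m1.mul m2)).sub ((m1.mul hK.measurable).mul cφ.measurable)).add m4
  have hJint : Integrable J μ :=
    hB.mono' hJm.aestronglyMeasurable (Eventually.of_forall hJB)
  refine ⟨hJint, ?_⟩
  have hJdB : ∀ δ, 0 < δ → δ ≤ 1 → ∀ q, ‖Jd δ q‖ ≤ B q := by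
    intro δ h0 h1 q
    have := bound4 q (eta δ (v q)) (sgnA δ (v q)) 0
      (∑ i, (sgnD δ (v q) * F i q) * fderiv ℝ v q (e i))
      (by rw [abs_of_pos (eta_pos h0 _)]; exact eta_le h0 h1 _) (abs_sgnA_le h0 _)
    rw [Real.norm_eq_abs]
    refine this.trans ?_
    simp only [B]
    refine add_le_add le_rfl ?_
    by_cases hq : q ∈ tsupport φ
    · refine mul_le_mul_of_nonneg_left ?_ (hφ0 q)
      refine (Finset.abs_sum_le_sum_abs _ _).trans (Finset.sum_le_sum fun i _ => ?_)
      rw [abs_mul]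
      refine mul_le_mul_of_nonneg_right ?_ (abs_nonneg _)
      rw [abs_mul, abs_of_nonneg (sgnD_nonneg h0 _)]
      calc sgnD δ (v q) * |F i q| ≤ sgnD δ (v q) * (|L| * |v q|) := by
            refine mul_le_mul_of_nonneg_left ((hL q hq i).trans ?_) (sgnD_nonneg h0 _)
            gcongr
            exact le_abs_self L
        _ = |L| * (|v q| * sgnD δ (v q)) := by ring
        _ ≤ |L| * 1 := by gcongr; exact abs_mul_sgnD_le h0 _
        _ = |L| := mul_one _
    · simp [z0 q hq]
  have hJdc : ∀ δ, 0 < δ → Continuous (Jd δ) := by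
    intro δ h0
    have c1 : Continuous (fun q => eta δ (v q)) := (contDiff_eta h0 (n := 0)).continuous.comp cv
    have c2 : Continuous (fun q => sgnA δ (v q)) := (contDiff_sgnA h0 (n := 0)).continuous.comp cv
    have c3 : Continuous (fun q => sgnD δ (v q)) := (continuous_sgnD h0).comp cv
    simp only [Jd]
    fun_prop
  have hpos : ∀ δ, 0 < δ → δ ≤ 1 → 0 ≤ ∫ q, Jd δ q ∂μ := by
    intro δ h0 h1
    have hint : Integrable (Jd δ) μ :=
      hB.mono' (hJdc δ h0).aestronglyMeasurable (Eventually.of_forall (hJdB δ h0 h1))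
    have k1 : ContDiff ℝ 1 (fun q => eta δ (v q)) := (contDiff_eta h0).comp hv1
    have k2 : ContDiff ℝ 1 (fun q => sgnA δ (v q)) := (contDiff_sgnA h0).comp hv1
    let A : H → ℝ := fun q => eta δ (v q) * φ q
    let G : Fin d → H → ℝ := fun i q => sgnA δ (v q) * φ q * F i q
      + ε * (eta δ (v q) * fderiv ℝ φ q (e i)) - ε * (sgnA δ (v q) * φ q * fderiv ℝ v q (e i))
    have hA : ContDiff ℝ 1 A := k1.mul hφ1
    have hG : ∀ i, ContDiff ℝ 1 (G i) := fun i =>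
      (((k2.mul hφ1).mul (hF i)).add (contDiff_const.mul (k1.mul (hdφ i)))).sub
        (contDiff_const.mul ((k2.mul hφ1).mul (hdv i)))
    have hAc : HasCompactSupport A := HasCompactSupport.intro hc fun q hq => by simp [A, z0 q hq]
    have hGc : ∀ i, HasCompactSupport (G i) := fun i =>
      HasCompactSupport.intro hc fun q hq => by simp [G, z0 q hq, z1 q hq]
    let D : H → ℝ := fun q => fderiv ℝ A q e0 + ∑ i, fderiv ℝ (G i) q (e i)
    have hDi : Integrable D μ := (integrable_fderiv_cc μ hA hAc e0).add
      (integrable_finsetSum _ fun i _ => integrable_fderiv_cc μ (hG i) (hGc i) (e i))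
    have hD0 : ∫ q, D q ∂μ = 0 := by
      simp only [D]
      rw [integral_add (integrable_fderiv_cc μ hA hAc e0)
        (integrable_finsetSum _ fun i _ => integrable_fderiv_cc μ (hG i) (hGc i) (e i)),
        integral_finsetSum _ fun i _ => integrable_fderiv_cc μ (hG i) (hGc i) (e i),
        integral_fderiv_cc μ hA hAc]
      simp [integral_fderiv_cc μ (hG _) (hGc _)]
    rw [← hD0]
    refine integral_mono hDi hint fun q => ?_
    have dv : HasFDerivAt v (fderiv ℝ v q) q := (hv1.differentiable one_ne_zero q).hasFDerivAt
    have dφ : HasFDerivAt φ (fderiv ℝ φ q) q := (hφ1.differentiable one_ne_zero q).hasFDerivAt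
    have d1 : HasFDerivAt (fun q => eta δ (v q)) (sgnA δ (v q) • fderiv ℝ v q) q :=
      (hasDerivAt_eta h0 (v q)).comp_hasFDerivAt q dv
    have d2 : HasFDerivAt (fun q => sgnA δ (v q)) (sgnD δ (v q) • fderiv ℝ v q) q :=
      (hasDerivAt_sgnA h0 (v q)).comp_hasFDerivAt q dv
    have eA : fderiv ℝ A q e0
        = eta δ (v q) * fderiv ℝ φ q e0 + φ q * (sgnA δ (v q) * fderiv ℝ v q e0) := by
      have : HasFDerivAt A _ q := d1.mul dφ
      rw [this.fderiv]; simp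
    have eG : ∀ i, fderiv ℝ (G i) q (e i)
        = sgnA δ (v q) * (F i q * fderiv ℝ φ q (e i))
          + (sgnA δ (v q) * φ q) * fderiv ℝ (F i) q (e i)
          + φ q * ((sgnD δ (v q) * F i q) * fderiv ℝ v q (e i))
          + ε * eta δ (v q) * fderiv ℝ (fun p => fderiv ℝ φ p (e i)) q (e i)
          - ε * (sgnA δ (v q) * φ q) * fderiv ℝ (fun p => fderiv ℝ v p (e i)) q (e i)
          - ε * φ q * sgnD δ (v q) * (fderiv ℝ v q (e i)) ^ 2 := by
      intro i
      have dF : HasFDerivAt (F i) (fderiv ℝ (F i) q) q :=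
        ((hF i).differentiable one_ne_zero q).hasFDerivAt
      have ddφ := ((hdφ i).differentiable one_ne_zero q).hasFDerivAt
      have ddv := ((hdv i).differentiable one_ne_zero q).hasFDerivAt
      have : HasFDerivAt (G i) _ q :=
        (((d2.mul dφ).mul dF).add ((d1.mul ddφ).const_mul ε)).sub
          (((d2.mul dφ).mul ddv).const_mul ε)
      rw [this.fderiv]
      simp
      ring
    simp only [D, Jd, eA]
    rw [Finset.sum_congr rfl fun i _ => eG i]
    simp only [Finset.sum_add_distrib, Finset.sum_sub_distrib, ← Finset.mul_sum]
    have hsq : 0 ≤ ε * φ q * sgnD δ (v q) * ∑ i, (fderiv ℝ v q (e i)) ^ 2 :=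
      mul_nonneg (mul_nonneg (mul_nonneg hε.le (hφ0 q)) (sgnD_nonneg h0 _))
        (Finset.sum_nonneg fun i _ => sq_nonneg _)
    have key : φ q * (sgnA δ (v q) * fderiv ℝ v q e0)
        + (sgnA δ (v q) * φ q) * ∑ i, fderiv ℝ (F i) q (e i) + sgnA δ (v q) * K q * φ q
        = ε * (sgnA δ (v q) * φ q) * ∑ i, fderiv ℝ (fun p => fderiv ℝ v p (e i)) q (e i) := by
      by_cases hq : q ∈ tsupport φ
      · linear_combination (sgnA δ (v q) * φ q) * heq q hq
      · simp [z0 q hq]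
    linarith
  -- pass to the limit
  let δn : ℕ → ℝ := fun n => 1 / ((n : ℝ) + 1)
  have hδ0 : ∀ n, 0 < δn n := fun n => by simp only [δn]; positivity
  have hδ1 : ∀ n, δn n ≤ 1 := fun n => by
    simp only [δn]; rw [div_le_one (by positivity)]; linarith [n.cast_nonneg (α := ℝ)]
  have hδt : Tendsto δn atTop (nhds 0) := tendsto_one_div_add_atTop_nhds_zero_nat
  have hlim : Tendsto (fun n => ∫ q, Jd (δn n) q ∂μ) atTop (nhds (∫ q, J q ∂μ)) := by
    refine tendsto_integral_of_dominated_convergence B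
      (fun n => (hJdc _ (hδ0 n)).aestronglyMeasurable) hB
      (fun n => Eventually.of_forall (hJdB _ (hδ0 n) (hδ1 n))) (Eventually.of_forall fun q => ?_)
    have l1 := (tendsto_eta (v q)).comp hδt
    have l2 := (tendsto_sgnA (v q)).comp hδt
    have l3 : Tendsto (fun n => φ q * ∑ i, (sgnD (δn n) (v q) * F i q) * fderiv ℝ v q (e i))
        atTop (nhds 0) := by
      by_cases hq : q ∈ tsupport φ
      · by_cases hvq : v q = 0
        · have : ∀ i, F i q = 0 := fun i => by
            have := hL q hq i
            rw [hvq, abs_zero, mul_zero] at this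
            exact abs_nonpos_iff.1 this
          simp [this]
        · have l := (tendsto_sgnD hvq).comp hδt
          have := (tendsto_finsetSum (Finset.univ : Finset (Fin d)) fun i _ =>
            (l.mul_const (F i q)).mul_const (fderiv ℝ v q (e i))).const_mul (φ q)
          simpa using this
      · simp [z0 q hq]
    have := ((((l1.mul_const (fderiv ℝ φ q e0)).add
      (l2.mul_const (∑ i, F i q * fderiv ℝ φ q (e i)))).sub
      ((l2.mul_const (K q)).mul_const (φ q))).add
      ((l1.const_mul ε).mul_const
        (∑ i, fderiv ℝ (fun p => fderiv ℝ φ p (e i)) q (e i)))).add l3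
    rw [add_zero] at this
    exact this
  exact ge_of_tendsto' hlim fun n => hpos _ (hδ0 n) (hδ1 n)
end abs

section translation
variable {d : ℕ}

lemma deriv_fst_eq {W : ℝ × EuclideanSpace ℝ (Fin d) → ℝ} {t : ℝ} {x : EuclideanSpace ℝ (Fin d)}
    (hW : DifferentiableAt ℝ W (t, x)) :
    deriv (fun s => W (s, x)) t = fderiv ℝ W (t, x) (1, 0) := by
  have h1 : HasDerivAt (fun s : ℝ => (s, x)) ((1 : ℝ), (0 : EuclideanSpace ℝ (Fin d))) t :=
    (hasDerivAt_id t).prodMk (hasDerivAt_const t x)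
  exact (hW.hasFDerivAt.comp_hasDerivAt t h1).deriv

lemma fderiv_snd_eq {W : ℝ × EuclideanSpace ℝ (Fin d) → ℝ} {t : ℝ} {x : EuclideanSpace ℝ (Fin d)}
    (hW : DifferentiableAt ℝ W (t, x)) (v : EuclideanSpace ℝ (Fin d)) :
    fderiv ℝ (fun y => W (t, y)) x v = fderiv ℝ W (t, x) (0, v) := by
  have h1 : HasFDerivAt (fun y : EuclideanSpace ℝ (Fin d) => (t, y))
      (ContinuousLinearMap.inr ℝ ℝ (EuclideanSpace ℝ (Fin d))) x :=
    hasFDerivAt_prodMk_right t x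
  have h2 : HasFDerivAt (fun y => W (t, y)) _ x := hW.hasFDerivAt.comp x h1
  rw [h2.fderiv]
  simp

lemma lap_eq {W : ℝ × EuclideanSpace ℝ (Fin d) → ℝ} (hW : ContDiff ℝ 2 W) (t : ℝ)
    (x : EuclideanSpace ℝ (Fin d)) :
    lap (fun y => W (t, y)) x = ∑ i : Fin d,
      fderiv ℝ (fun q => fderiv ℝ W q (0, EuclideanSpace.single i 1)) (t, x)
        (0, EuclideanSpace.single i 1) := by
  unfold lap
  refine Finset.sum_congr rfl fun i _ => ?_
  have h1 : (fun y => fderiv ℝ (fun y => W (t, y)) y (EuclideanSpace.single i 1))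
      = fun y => fderiv ℝ W (t, y) (0, EuclideanSpace.single i 1) := by
    funext y
    exact fderiv_snd_eq (hW.differentiable (by norm_num) _) _
  have h2 : ContDiff ℝ 1 (fun q => fderiv ℝ W q (0, EuclideanSpace.single i 1)) :=
    (hW.fderiv_right (m := 1) (by norm_num)).clm_apply contDiff_const
  rw [h1]
  exact fderiv_snd_eq (W := fun q => fderiv ℝ W q (0, EuclideanSpace.single i 1))
    (h2.differentiable one_ne_zero _) _

lemma divg_eq {h : EuclideanSpace ℝ (Fin d) → EuclideanSpace ℝ (Fin d)}
    {x : EuclideanSpace ℝ (Fin d)} (hh : DifferentiableAt ℝ h x) :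
    divg h x = ∑ i, fderiv ℝ (fun y => h y i) x (EuclideanSpace.single i 1) := by
  unfold divg
  refine Finset.sum_congr rfl fun i _ => ?_
  have : HasFDerivAt (fun y => h y i) _ x :=
    (EuclideanSpace.proj i : EuclideanSpace ℝ (Fin d) →L[ℝ] ℝ).hasFDerivAt.comp x hh.hasFDerivAt
  rw [this.fderiv]
  simp

lemma divg_congr {h k : EuclideanSpace ℝ (Fin d) → EuclideanSpace ℝ (Fin d)}
    {x : EuclideanSpace ℝ (Fin d)} (hh : h =ᶠ[nhds x] k) : divg h x = divg k x := by
  unfold divg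
  rw [hh.fderiv_eq]

lemma lap_congr {h k : EuclideanSpace ℝ (Fin d) → ℝ}
    {x : EuclideanSpace ℝ (Fin d)} (hh : h =ᶠ[nhds x] k) : lap h x = lap k x := by
  unfold lap
  refine Finset.sum_congr rfl fun i _ => ?_
  have : (fun y => fderiv ℝ h y (EuclideanSpace.single i 1))
      =ᶠ[nhds x] fun y => fderiv ℝ k y (EuclideanSpace.single i 1) :=
    (hh.fderiv (𝕜 := ℝ)).mono fun y hy => by simp only [hy]
  rw [this.fderiv_eq]

lemma inner_gradient_eq (a : EuclideanSpace ℝ (Fin d)) (f : EuclideanSpace ℝ (Fin d) → ℝ)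
    (x : EuclideanSpace ℝ (Fin d)) :
    ⟪a, gradient f x⟫ = ∑ i, a i * fderiv ℝ f x (EuclideanSpace.single i 1) := by
  rw [inner_gradient_right]
  simp only [conj_trivial]
  conv_lhs => rw [← (EuclideanSpace.basisFun (Fin d) ℝ).sum_repr a]
  simp [map_sum]

open scoped Manifold ContDiff in
lemma exists_cutoff {u : ℝ × EuclideanSpace ℝ (Fin d) → ℝ} {U S : Set (ℝ × EuclideanSpace ℝ (Fin d))}
    (hU : IsOpen U) (hS : IsClosed S) (hSU : S ⊆ U) (hu : ContDiffOn ℝ 2 u U) :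
    ∃ w : ℝ × EuclideanSpace ℝ (Fin d) → ℝ, ContDiff ℝ 2 w ∧ ∀ q ∈ S, u =ᶠ[nhds q] w := by
  obtain ⟨f, h0, h1, -⟩ := exists_contMDiffMap_zero_one_nhds_of_isClosed
    (n := (⊤ : ℕ∞)) 𝓘(ℝ, ℝ × EuclideanSpace ℝ (Fin d)) hU.isClosed_compl hS
    (by rw [disjoint_compl_left_iff_subset]; exact hSU)
  have hf : ContDiff ℝ 2 f := f.contMDiff.contDiff.of_le (WithTop.coe_le_coe.2 (le_top : (2 : ℕ∞) ≤ ⊤))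
  refine ⟨fun q => f q * u q, ?_, ?_⟩
  · rw [contDiff_iff_contDiffAt]
    intro q
    by_cases hq : q ∈ U
    · exact hf.contDiffAt.mul (hu.contDiffAt (hU.mem_nhds hq))
    · have : ∀ᶠ p in nhds q, f p = 0 := (eventually_nhdsSet_iff_forall.1 h0) q hq
      refine (contDiffAt_const (c := (0:ℝ))).congr_of_eventuallyEq ?_
      filter_upwards [this] with p hp
      simp [hp]
  · intro q hq
    filter_upwards [(eventually_nhdsSet_iff_forall.1 h1) q hq] with p hp
    simp [hp]

end translation

/-- **Kruzhkov entropy inequality for classical solutions of the viscous problem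
with `x`-dependent flux.**  A bounded `C²` classical solution of
`∂_t u + div_x 𝔤(x,u) = ε Δ u` on `(0,T) × ℝ^d` satisfies, for every `λ ∈ ℝ` and
every nonnegative `φ ∈ C_c^∞((0,T) × ℝ^d)`,
`∫∫ (|u−λ| ∂_t φ + sgn(u−λ)(𝔤(x,u)−𝔤(x,λ))·∇φ − sgn(u−λ)(div_x 𝔤)(x,λ) φ + ε|u−λ| Δφ) ≥ 0`. -/
theorem entropy_inequality_viscous
    (d : ℕ) (hd : 1 ≤ d) (T ε : ℝ) (hT : 0 < T) (hε : 0 < ε)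
    (g : EuclideanSpace ℝ (Fin d) → ℝ → EuclideanSpace ℝ (Fin d))
    (hg : ContDiff ℝ 1 (fun p : EuclideanSpace ℝ (Fin d) × ℝ => g p.1 p.2))
    (u : ℝ → EuclideanSpace ℝ (Fin d) → ℝ)
    (hubd : ∃ M, ∀ t ∈ Ioo (0 : ℝ) T, ∀ x, |u t x| ≤ M)
    (huC2 : ContDiffOn ℝ 2 (fun q : ℝ × EuclideanSpace ℝ (Fin d) => u q.1 q.2)
      (Ioo 0 T ×ˢ univ))
    (hueq : ∀ t ∈ Ioo (0 : ℝ) T, ∀ x,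
      deriv (fun s => u s x) t + divg (fun y => g y (u t y)) x = ε * lap (u t) x) :
    ∀ (l : ℝ) (φ : ℝ → EuclideanSpace ℝ (Fin d) → ℝ),
      ContDiff ℝ (⊤ : ℕ∞) (uncurry φ) → HasCompactSupport (uncurry φ) →
      tsupport (uncurry φ) ⊆ Ioo 0 T ×ˢ univ → (∀ t x, 0 ≤ φ t x) →
      0 ≤ ∫ t in Ioo (0 : ℝ) T, ∫ x,
        (|u t x - l| * deriv (fun s => φ s x) t
          + Real.sign (u t x - l) * ⟪g x (u t x) - g x l, gradient (φ t) x⟫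
          - Real.sign (u t x - l) * divg (fun y => g y l) x * φ t x
          + ε * |u t x - l| * lap (φ t) x) := by
  intro l φ hφ hc hsupp hφ0
  set Φ : ℝ × EuclideanSpace ℝ (Fin d) → ℝ := uncurry φ with hΦ
  obtain ⟨w, hw, hwu⟩ := exists_cutoff (isOpen_Ioo.prod isOpen_univ) (isClosed_tsupport Φ)
    hsupp huC2
  have hφ2 : ContDiff ℝ 2 Φ := hφ.of_le (WithTop.coe_le_coe.2 (le_top : (2 : ℕ∞) ≤ ⊤))
  have hcg : ∀ i : Fin d, ContDiff ℝ 1 (fun p : EuclideanSpace ℝ (Fin d) × ℝ => g p.1 p.2 i) :=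
    fun i => (EuclideanSpace.proj i : EuclideanSpace ℝ (Fin d) →L[ℝ] ℝ).contDiff.comp hg
  have hw1 : ContDiff ℝ 1 w := hw.of_le (by norm_num)
  let F : Fin d → ℝ × EuclideanSpace ℝ (Fin d) → ℝ := fun i q => g q.2 (w q) i - g q.2 l i
  have hF : ∀ i, ContDiff ℝ 1 (F i) := fun i =>
    ((hcg i).comp (contDiff_snd.prodMk hw1)).sub ((hcg i).comp (contDiff_snd.prodMk contDiff_const))
  have hgl : ContDiff ℝ 1 (fun y => g y l) := hg.comp (contDiff_id.prodMk contDiff_const)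
  let K : ℝ × EuclideanSpace ℝ (Fin d) → ℝ := fun q => divg (fun y => g y l) q.2
  have hK : Continuous K := by
    have : Continuous (fun x => divg (fun y => g y l) x) := by
      unfold divg
      refine continuous_finsetSum _ fun i _ => ?_
      exact (EuclideanSpace.proj i : EuclideanSpace ℝ (Fin d) →L[ℝ] ℝ).continuous.comp
        ((hgl.continuous_fderiv one_ne_zero).clm_apply continuous_const)
    exact this.comp continuous_snd
  obtain ⟨L, hL⟩ : ∃ L : ℝ, ∀ q ∈ tsupport Φ, ∀ i, |F i q| ≤ L * |w q - l| := by
    have c1 : IsCompact ((fun q : ℝ × EuclideanSpace ℝ (Fin d) => (q.2, w q)) '' tsupport Φ) :=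
      hc.isCompact.image (by have := hw.continuous; fun_prop)
    have c2 : IsCompact ((fun q : ℝ × EuclideanSpace ℝ (Fin d) => (q.2, l)) '' tsupport Φ) :=
      hc.isCompact.image (by fun_prop)
    obtain ⟨R, hR⟩ := (c1.union c2).isBounded.subset_closedBall 0
    obtain ⟨L, hL⟩ := (hg.contDiffOn (s := Metric.closedBall 0 R)).exists_lipschitzOnWith
      one_ne_zero (convex_closedBall _ _) (isCompact_closedBall _ _)
    refine ⟨L, fun q hq i => ?_⟩
    have := hL.dist_le_mul _ (hR (Or.inl (mem_image_of_mem _ hq))) _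
      (hR (Or.inr (mem_image_of_mem _ hq)))
    rw [dist_eq_norm] at this
    have h2 : dist (q.2, w q) (q.2, l) = |w q - l| := by
      simp [Prod.dist_eq, Real.dist_eq]
    rw [h2] at this
    refine le_trans ?_ this
    have := PiLp.norm_apply_le (g q.2 (w q) - g q.2 l) i
    simpa [F] using this
  have hfv : ∀ p, fderiv ℝ (fun q => w q - l) p = fderiv ℝ w p := fun p => by
    rw [fderiv_sub_const]
  have heq : ∀ q ∈ tsupport Φ, fderiv ℝ (fun q => w q - l) q (1, 0)
      + ∑ i, fderiv ℝ (F i) q (0, EuclideanSpace.single i 1) + K q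
      = ε * ∑ i, fderiv ℝ (fun p => fderiv ℝ (fun q => w q - l) p
          (0, EuclideanSpace.single i 1)) q (0, EuclideanSpace.single i 1) := by
    rintro ⟨t, x⟩ hq
    have ht : t ∈ Ioo 0 T := (hsupp hq).1
    have h := hueq t ht x
    have e1 := hwu _ hq
    have e2 : (fun y => u t y) =ᶠ[nhds x] fun y => w (t, y) :=
      (by fun_prop : ContinuousAt (fun y : EuclideanSpace ℝ (Fin d) => (t, y)) x).eventually e1
    have e3 : (fun s => u s x) =ᶠ[nhds t] fun s => w (s, x) :=
      (by fun_prop : ContinuousAt (fun s : ℝ => (s, x)) t).eventually e1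
    have e4 : (fun y => g y (u t y)) =ᶠ[nhds x] fun y => g y (w (t, y)) :=
      e2.mono fun y hy => by simp only [hy]
    have e5 : lap (u t) x = lap (fun y => w (t, y)) x := lap_congr e2
    rw [e3.deriv_eq, deriv_fst_eq (hw1.differentiable one_ne_zero _), e5, lap_eq hw,
      divg_congr e4] at h
    simp only [hfv]
    rw [← h]
    have dgw : ContDiff ℝ 1 (fun y => g y (w (t, y))) :=
      hg.comp (contDiff_id.prodMk (hw1.comp (contDiff_const.prodMk contDiff_id)))
    have e6 : divg (fun y => g y (w (t, y))) x
        = ∑ i, fderiv ℝ (F i) (t, x) (0, EuclideanSpace.single i 1) + K (t, x) := by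
      simp only [K]
      rw [divg_eq (dgw.differentiable one_ne_zero _), divg_eq (hgl.differentiable one_ne_zero _),
        ← Finset.sum_add_distrib]
      refine Finset.sum_congr rfl fun i _ => ?_
      rw [← fderiv_snd_eq ((hF i).differentiable one_ne_zero _)]
      have a1 : DifferentiableAt ℝ (fun y => g y (w (t, y)) i) x :=
        ((EuclideanSpace.proj i : EuclideanSpace ℝ (Fin d) →L[ℝ] ℝ).contDiff.comp
          dgw).differentiable one_ne_zero _
      have a2 : DifferentiableAt ℝ (fun y => g y l i) x :=
        ((EuclideanSpace.proj i : EuclideanSpace ℝ (Fin d) →L[ℝ] ℝ).contDiff.comp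
          hgl).differentiable one_ne_zero _
      have : fderiv ℝ (fun y => F i (t, y)) x = _ := fderiv_fun_sub a1 a2
      rw [this]
      simp
    rw [e6]; ring
  obtain ⟨hJ, hJ0⟩ := abstract_entropy
    ((volume : Measure ℝ).prod (volume : Measure (EuclideanSpace ℝ (Fin d))))
    (fun q => w q - l) Φ K F (1, 0) (fun i => (0, EuclideanSpace.single i 1)) ε L hε
    (hw.sub contDiff_const) hφ2 hc (fun q => hφ0 q.1 q.2) hK hF hL heq
  have z0 : ∀ q, q ∉ tsupport Φ → Φ q = 0 := fun q hq => image_eq_zero_of_notMem_tsupport hq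
  have z1 : ∀ q, q ∉ tsupport Φ → fderiv ℝ Φ q = 0 := fun q hq =>
    image_eq_zero_of_notMem_tsupport (fun h => hq (tsupport_fderiv_subset ℝ h))
  have z2 : ∀ q, q ∉ tsupport Φ → ∀ e, fderiv ℝ (fun p => fderiv ℝ Φ p e) q = 0 := by
    intro q hq e
    apply image_eq_zero_of_notMem_tsupport
    intro h
    exact hq ((tsupport_fderiv_subset ℝ).trans (tsupport_fderiv_apply_subset ℝ e) h)
  rw [integral_prod _ hJ] at hJ0
  rw [← setIntegral_eq_integral_of_forall_compl_eq_zero (s := Ioo 0 T)] at hJ0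
  · refine hJ0.trans_eq ?_
    congr 1
    funext t
    congr 1
    funext x
    have dΦ : DifferentiableAt ℝ Φ (t, x) := hφ2.differentiable (by norm_num) _
    have b1 : deriv (fun s => φ s x) t = fderiv ℝ Φ (t, x) (1, 0) := deriv_fst_eq dΦ
    have b2 : lap (φ t) x = _ := lap_eq hφ2 t x
    have b3 : ∀ i, fderiv ℝ (φ t) x (EuclideanSpace.single i 1)
        = fderiv ℝ Φ (t, x) (0, EuclideanSpace.single i 1) := fun i => fderiv_snd_eq dΦ _
    have b4 : φ t x = Φ (t, x) := rfl
    rw [b1, b2, inner_gradient_eq, b4]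
    simp only [b3]
    by_cases hq : (t, x) ∈ tsupport Φ
    · have : u t x = w (t, x) := (hwu _ hq).self_of_nhds
      simp [F, K, this]
    · simp [z0 _ hq, z1 _ hq, z2 _ hq]
  · intro t ht
    have : ∀ x, (t, x) ∉ tsupport Φ := fun x h => ht (hsupp h).1
    simp [z0 _ (this _), z1 _ (this _), z2 _ (this _)]
end

section
/- Let d ≥ 1, T > 0, N > 0, C ≥ 0, x₀ ∈ ℝ^d, R > 0. Let w ∈ L^∞((0,T) × ℝ^d) with w ≥ 0 a.e., and let V : (0,T) × ℝ^d → ℝ^d be measurable with ‖V(t,x)‖ ≤ N for a.e. (t,x) (Euclidean norm). Assume that w is a distributional subsolution of the transport inequality ∂_t w + div_x (V w) ≤ C w with zero initial data, i.e. for every nonnegative φ ∈ C_c^∞([0,T) × ℝ^d): ∫₀^T ∫_{ℝ^d} ( w ∂_t φ + w V · ∇_x φ + C w φ ) dx dt ≥ 0. Then w = 0 almost everywhere on the cone { (t,x) : 0 < t < min(T, R/N), ‖x − x₀‖ < R − N t }. -/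
open Set MeasureTheory Function Filter
open scoped RealInnerProductSpace

lemma fsp_deriv_formulas {E : Type*} [NormedAddCommGroup E] [InnerProductSpace ℝ E]
    [CompleteSpace E] (φ : ℝ → E → ℝ) (h : ContDiff ℝ (⊤ : ℕ∞) (uncurry φ)) (q : ℝ × E) (v : E) :
    deriv (fun s => φ s q.2) q.1 + ⟪v, gradient (φ q.1) q.2⟫ = fderiv ℝ (uncurry φ) q (1, v) := by
  have hd : HasFDerivAt (uncurry φ) (fderiv ℝ (uncurry φ) q) q :=
    ((h.differentiable (by simp)) q).hasFDerivAt
  have h1 : HasDerivAt (fun s => φ s q.2) (fderiv ℝ (uncurry φ) q (1, 0)) q.1 := by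
    have hg : HasDerivAt (fun s : ℝ => (s, q.2)) ((1 : ℝ), (0 : E)) q.1 :=
      (hasDerivAt_id q.1).prodMk (hasDerivAt_const q.1 q.2)
    exact HasFDerivAt.comp_hasDerivAt (f := fun s : ℝ => (s, q.2)) q.1 hd hg
  have h2 : HasFDerivAt (φ q.1)
      ((fderiv ℝ (uncurry φ) q).comp (ContinuousLinearMap.inr ℝ ℝ E)) q.2 :=
    HasFDerivAt.comp (f := fun x : E => (q.1, x)) q.2 hd (hasFDerivAt_prodMk_right q.1 q.2)
  rw [h1.deriv, inner_gradient_right, h2.fderiv]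
  simp only [ContinuousLinearMap.comp_apply, ContinuousLinearMap.inr_apply, conj_trivial]
  rw [← map_add]
  simp

lemma fsp_integrable_aux {F : Type*} [NormedAddCommGroup F] [NormedSpace ℝ F]
    [FiniteDimensional ℝ F] [MeasurableSpace F] [BorelSpace F]
    (S : Set F) (hS : MeasurableSet S) (μ : Measure F) [IsFiniteMeasureOnCompacts μ]
    (K C M : ℝ) (hC : 0 ≤ C) (w : F → ℝ) (V : F → F)
    (hw : Measurable w) (hV : Measurable V)
    (hwb : ∀ᵐ q ∂μ, q ∈ S → |w q| ≤ M) (hVb : ∀ᵐ q ∂μ, q ∈ S → ‖V q‖ ≤ K)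
    (Φ : F → ℝ) (h : ContDiff ℝ (⊤ : ℕ∞) Φ) (hc : HasCompactSupport Φ) :
    Integrable (fun q => w q * fderiv ℝ Φ q (V q) + C * w q * Φ q) (μ.restrict S) := by
  have hcd : Continuous (fderiv ℝ Φ) := h.continuous_fderiv (by simp)
  have i1 : Integrable (fun q => ‖fderiv ℝ Φ q‖) μ :=
    hcd.norm.integrable_of_hasCompactSupport (hc.fderiv (𝕜 := ℝ)).norm
  have i2 : Integrable (fun q => |Φ q|) μ :=
    h.continuous.abs.integrable_of_hasCompactSupport hc.norm
  have hG : Integrable (fun q => M * (‖fderiv ℝ Φ q‖ * K + C * |Φ q|)) (μ.restrict S) :=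
    (((i1.mul_const K).add (i2.const_mul C)).const_mul M).restrict
  have : ProperSpace F := FiniteDimensional.proper_real F
  have : SecondCountableTopology F := inferInstance
  refine hG.mono' ?_ ?_
  · apply AEStronglyMeasurable.add
    · apply hw.aestronglyMeasurable.mul
      have h1 : AEStronglyMeasurable (fderiv ℝ Φ) (μ.restrict S) := hcd.aestronglyMeasurable
      have h2 : AEStronglyMeasurable V (μ.restrict S) := hV.aestronglyMeasurable
      exact (ContinuousLinearMap.id ℝ (F →L[ℝ] ℝ)).aestronglyMeasurable_comp₂ h1 h2
    · exact (hw.aestronglyMeasurable.const_mul C).mul h.continuous.aestronglyMeasurable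
  · rw [ae_restrict_iff' hS]
    filter_upwards [hwb, hVb] with q h1 h2 hq
    have h1 := h1 hq
    have h2 := h2 hq
    have h3 : ‖fderiv ℝ Φ q (V q)‖ ≤ ‖fderiv ℝ Φ q‖ * K := by
      refine (ContinuousLinearMap.le_opNorm _ _).trans ?_
      gcongr
    have h4 : w q * fderiv ℝ Φ q (V q) + C * w q * Φ q
      = w q * (fderiv ℝ Φ q (V q) + C * Φ q) := by ring
    rw [h4, norm_mul]
    have h5 : ‖fderiv ℝ Φ q (V q) + C * Φ q‖ ≤ ‖fderiv ℝ Φ q‖ * K + C * |Φ q| := by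
      refine (norm_add_le _ _).trans ?_
      rw [norm_mul, Real.norm_of_nonneg hC]
      exact add_le_add h3 le_rfl
    exact mul_le_mul h1 h5 (norm_nonneg _) ((abs_nonneg _).trans h1)

lemma fsp_integrable {E : Type*} [NormedAddCommGroup E] [InnerProductSpace ℝ E]
    [FiniteDimensional ℝ E] [MeasurableSpace E] [BorelSpace E]
    (S : Set (ℝ × E)) (hS : MeasurableSet S) (μ : Measure (ℝ × E)) [IsFiniteMeasureOnCompacts μ]
    (N C M : ℝ) (hN : 0 ≤ N) (hC : 0 ≤ C) (w : ℝ × E → ℝ) (V : ℝ × E → E)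
    (hw : Measurable w) (hV : Measurable V)
    (hwb : ∀ᵐ q ∂μ, q ∈ S → |w q| ≤ M) (hVb : ∀ᵐ q ∂μ, q ∈ S → ‖V q‖ ≤ N)
    (Φ : ℝ × E → ℝ) (h : ContDiff ℝ (⊤ : ℕ∞) Φ) (hc : HasCompactSupport Φ) :
    Integrable (fun q => w q * fderiv ℝ Φ q (1, V q) + C * w q * Φ q) (μ.restrict S) := by
  refine fsp_integrable_aux S hS μ (1 + N) C M hC w (fun q => (1, V q)) hw
    (measurable_const.prodMk hV) hwb ?_ Φ h hc
  filter_upwards [hVb] with q h2 hq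
  have h2 := h2 hq
  rw [Prod.norm_mk]
  apply max_le
  · simp only [norm_one]; linarith
  · linarith

noncomputable def fspPhi {E : Type*} [NormedAddCommGroup E] (T' N C R ε : ℝ) (x₀ : E)
    (t : ℝ) (x : E) : ℝ :=
  Real.smoothTransition (t + 1) * (Real.exp (-(C + 1) * t) * Real.smoothTransition (T' - t)) *
    Real.smoothTransition (R - N * t - √(ε ^ 2 + ‖x - x₀‖ ^ 2))

lemma fsp_contDiff {E : Type*} [NormedAddCommGroup E] [InnerProductSpace ℝ E]
    (T' N C R ε : ℝ) (hε : 0 < ε) (x₀ : E) :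
    ContDiff ℝ (⊤ : ℕ∞) (uncurry (fspPhi T' N C R ε x₀)) := by
  have hr : ContDiff ℝ (⊤ : ℕ∞) (fun q : ℝ × E => √(ε ^ 2 + ‖q.2 - x₀‖ ^ 2)) := by
    apply ContDiff.sqrt
    · exact contDiff_const.add ((contDiff_snd.sub contDiff_const).norm_sq ℝ)
    · intro q; positivity
  have hs : ∀ f : ℝ × E → ℝ, ContDiff ℝ (⊤ : ℕ∞) f →
      ContDiff ℝ (⊤ : ℕ∞) (fun q => Real.smoothTransition (f q)) :=
    fun f hf => Real.smoothTransition.contDiff.comp hf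
  unfold fspPhi uncurry
  refine ((hs _ ?_).mul (ContDiff.mul ?_ (hs _ ?_))).mul (hs _ ?_)
  · fun_prop
  · fun_prop
  · fun_prop
  · exact ContDiff.sub (by fun_prop) hr

lemma fsp_nonneg {E : Type*} [NormedAddCommGroup E]
    (T' N C R ε : ℝ) (x₀ : E) (t : ℝ) (x : E) : 0 ≤ fspPhi T' N C R ε x₀ t x := by
  unfold fspPhi
  have := Real.smoothTransition.nonneg
  have h1 := this (t + 1)
  have h2 := this (T' - t)
  have h3 := this (R - N * t - √(ε ^ 2 + ‖x - x₀‖ ^ 2))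
  positivity

lemma fsp_support {E : Type*} [NormedAddCommGroup E]
    (T' N C R ε : ℝ) (hN : 0 ≤ N) (x₀ : E) :
    support (uncurry (fspPhi T' N C R ε x₀)) ⊆ Icc (-1) T' ×ˢ Metric.closedBall x₀ (R + N) := by
  rintro ⟨t, x⟩ h
  simp only [mem_support, uncurry, fspPhi, ne_eq, mul_eq_zero, not_or,
    Real.smoothTransition.zero_iff_nonpos, not_le] at h
  obtain ⟨⟨h1, -, h2⟩, h3⟩ := h
  refine ⟨⟨by linarith, by linarith⟩, ?_⟩
  have h4 : ‖x - x₀‖ ≤ √(ε ^ 2 + ‖x - x₀‖ ^ 2) := Real.le_sqrt_of_sq_le (by nlinarith [sq_nonneg ε])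
  simp only [Metric.mem_closedBall, dist_eq_norm]
  nlinarith

lemma fsp_pointwise {E : Type*} [NormedAddCommGroup E] [InnerProductSpace ℝ E] [CompleteSpace E]
    (T' N C R ε : ℝ) (hN : 0 ≤ N) (hε : 0 < ε) (x₀ : E) (t : ℝ) (ht : 0 < t) (x v : E)
    (hv : ‖v‖ ≤ N) :
    deriv (fun s => fspPhi T' N C R ε x₀ s x) t + ⟪v, gradient (fspPhi T' N C R ε x₀ t) x⟫
      + C * fspPhi T' N C R ε x₀ t x ≤ - fspPhi T' N C R ε x₀ t x := by
  set σ := Real.smoothTransition with hσ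
  have hσd : ∀ y, HasDerivAt σ (deriv σ y) y := fun y =>
    ((Real.smoothTransition.contDiff (n := 1)).differentiable (by simp) y).hasDerivAt
  have hσp : ∀ y, 0 ≤ deriv σ y := fun y => Real.smoothTransition.monotone.deriv_nonneg
  have hσn : ∀ y, 0 ≤ σ y := Real.smoothTransition.nonneg
  set r : E → ℝ := fun x => √(ε ^ 2 + ‖x - x₀‖ ^ 2) with hr
  have hpos : 0 < ε ^ 2 + ‖x - x₀‖ ^ 2 := by positivity
  have hrpos : 0 < r x := Real.sqrt_pos.2 hpos
  have hrge : ‖x - x₀‖ ≤ r x := Real.le_sqrt_of_sq_le (by nlinarith [sq_nonneg ε])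
  have hone : σ (t + 1) = 1 := Real.smoothTransition.one_of_one_le (by linarith)
  set e := Real.exp (-(C + 1) * t) with he
  have hepos : 0 < e := Real.exp_pos _
  set y := R - N * t - r x with hy
  have hval : fspPhi T' N C R ε x₀ t x = e * σ (T' - t) * σ y := by
    simp only [fspPhi, ← hσ, hone, one_mul, hy, hr, he]
  -- time derivative
  have h1 : HasDerivAt (fun s => fspPhi T' N C R ε x₀ s x)
      ((e * (-(C + 1)) * σ (T' - t) + e * (deriv σ (T' - t) * (-1))) * σ y
        + e * σ (T' - t) * (deriv σ y * (-N))) t := by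
    have ha : HasDerivAt (fun s => Real.exp (-(C + 1) * s)) (e * (-(C + 1))) t := by
      have := ((hasDerivAt_id t).const_mul (-(C + 1))).exp
      simpa only [id, mul_one] using this
    have hb : HasDerivAt (fun s => σ (T' - s)) (deriv σ (T' - t) * (-1)) t :=
      (hσd (T' - t)).comp t ((hasDerivAt_id t).const_sub T')
    have hc : HasDerivAt (fun s => σ (R - N * s - r x)) (deriv σ y * (-N)) t := by
      have : HasDerivAt (fun s => R - N * s - r x) (-N) t := by
        have := (((hasDerivAt_id t).const_mul N).const_sub R).sub_const (r x)
        simpa using this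
      exact HasDerivAt.comp (h := fun s => R - N * s - r x) t (hσd y) this
    refine ((ha.mul hb).mul hc).congr_of_eventuallyEq ?_
    filter_upwards [lt_mem_nhds ht] with s hs
    have : σ (s + 1) = 1 := Real.smoothTransition.one_of_one_le (by linarith)
    simp [fspPhi, ← hσ, this, hr]
  -- space derivative
  set L : E →L[ℝ] ℝ := innerSL ℝ (x - x₀) with hL
  have h2 : HasFDerivAt (fspPhi T' N C R ε x₀ t)
      ((e * σ (T' - t)) • (deriv σ y • -((1 / (2 * r x)) • ((2 : ℕ) • L)))) x := by
    have ha : HasFDerivAt (fun z => ε ^ 2 + ‖z - x₀‖ ^ 2) ((2 : ℕ) • L) x := by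
      have := (((hasFDerivAt_id (𝕜 := ℝ) x).sub_const x₀).norm_sq).const_add (ε ^ 2)
      simpa only [id, ContinuousLinearMap.comp_id] using this
    have hb : HasFDerivAt r ((1 / (2 * r x)) • ((2 : ℕ) • L)) x := ha.sqrt hpos.ne'
    have hc : HasFDerivAt (fun z => σ (R - N * t - r z))
        (deriv σ y • -((1 / (2 * r x)) • ((2 : ℕ) • L))) x :=
      HasDerivAt.comp_hasFDerivAt (f := fun z => R - N * t - r z) x (hσd y) (hb.const_sub _)
    have := hc.const_mul (e * σ (T' - t))
    refine this.congr_of_eventuallyEq (Eventually.of_forall fun z => ?_)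
    simp only [fspPhi, ← hσ, hone, one_mul, hr, he]
  rw [h1.deriv, inner_gradient_right, h2.fderiv, hval]
  simp only [conj_trivial, smul_apply, neg_apply,
    hL, innerSL_apply_apply, smul_eq_mul, nsmul_eq_mul]
  have hin : -(1 / (2 * r x) * (((2 : ℕ) : ℝ) * ⟪x - x₀, v⟫)) ≤ N := by
    have h3 : -⟪x - x₀, v⟫ ≤ r x * N := by
      refine (neg_le_abs _).trans ((abs_real_inner_le_norm _ _).trans ?_)
      exact mul_le_mul hrge hv (norm_nonneg _) hrpos.le
    have h4 : -(1 / (2 * r x) * (((2 : ℕ) : ℝ) * ⟪x - x₀, v⟫)) = (-⟪x - x₀, v⟫) / r x := by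
      push_cast; field_simp
    rw [h4, div_le_iff₀ hrpos]
    linarith
  have h5 := mul_le_mul_of_nonneg_left hin
    (mul_nonneg (mul_nonneg hepos.le (hσn (T' - t))) (hσp y))
  have h6 := mul_nonneg (mul_nonneg hepos.le (hσp (T' - t))) (hσn y)
  simp only [← mul_assoc, ← mul_neg] at h5 ⊢
  linarith

/-- **Finite speed of propagation for transport subsolutions with zero initial trace.**
If `w ≥ 0` is a bounded distributional subsolution of `∂_t w + div(Vw) ≤ Cw` on
`(0,T) × ℝ^d` with zero initial data (encoded by testing against nonnegative
`φ ∈ C_c^∞([0,T) × ℝ^d)` which need not vanish at `t = 0`), and `‖V‖ ≤ N` a.e.,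
then `w = 0` a.e. on the cone `{(t,x) : 0 < t < min(T, R/N), ‖x−x₀‖ < R − Nt}`. -/
theorem finite_speed_propagation
    (d : ℕ) (hd : 1 ≤ d) (T N C R : ℝ) (hT : 0 < T) (hN : 0 < N) (hC : 0 ≤ C) (hR : 0 < R)
    (x₀ : EuclideanSpace ℝ (Fin d))
    (w : ℝ × EuclideanSpace ℝ (Fin d) → ℝ)
    (V : ℝ × EuclideanSpace ℝ (Fin d) → EuclideanSpace ℝ (Fin d))
    (hwmeas : Measurable w)
    (hwbd : ∃ M, ∀ᵐ q : ℝ × EuclideanSpace ℝ (Fin d), q.1 ∈ Ioo 0 T → |w q| ≤ M)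
    (hwnn : ∀ᵐ q : ℝ × EuclideanSpace ℝ (Fin d), q.1 ∈ Ioo 0 T → 0 ≤ w q)
    (hVmeas : Measurable V)
    (hVbd : ∀ᵐ q : ℝ × EuclideanSpace ℝ (Fin d), q.1 ∈ Ioo 0 T → ‖V q‖ ≤ N)
    (hsub : ∀ φ : ℝ → EuclideanSpace ℝ (Fin d) → ℝ,
      ContDiff ℝ (⊤ : ℕ∞) (uncurry φ) → HasCompactSupport (uncurry φ) →
      tsupport (uncurry φ) ⊆ Iio T ×ˢ univ → (∀ t x, 0 ≤ φ t x) →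
      0 ≤ ∫ q in (Ioo (0 : ℝ) T ×ˢ (univ : Set (EuclideanSpace ℝ (Fin d)))),
        (w q * deriv (fun s => φ s q.2) q.1
          + w q * ⟪V q, gradient (φ q.1) q.2⟫
          + C * w q * φ q.1 q.2)) :
    ∀ᵐ q : ℝ × EuclideanSpace ℝ (Fin d),
      (0 < q.1 ∧ q.1 < min T (R / N) ∧ ‖q.2 - x₀‖ < R - N * q.1) → w q = 0 := by
  obtain ⟨M, hM⟩ := hwbd
  have hS : MeasurableSet (Ioo (0 : ℝ) T ×ˢ (univ : Set (EuclideanSpace ℝ (Fin d)))) :=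
    measurableSet_Ioo.prod MeasurableSet.univ
  have key : ∀ n : ℕ, ∀ᵐ q : ℝ × EuclideanSpace ℝ (Fin d), q.1 ∈ Ioo 0 T →
      w q * fspPhi (T - 1 / ((n : ℝ) + 1)) N C R (1 / ((n : ℝ) + 1)) x₀ q.1 q.2 = 0 := by
    intro n
    have hε : 0 < 1 / ((n : ℝ) + 1) := by positivity
    set ε := 1 / ((n : ℝ) + 1) with hεd
    set φ := fspPhi (T - ε) N C R ε x₀ with hφ
    have hcd : ContDiff ℝ (⊤ : ℕ∞) (uncurry φ) := fsp_contDiff _ _ _ _ _ hε _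
    have hsupp := fsp_support (T - ε) N C R ε hN.le x₀
    have hK : IsCompact (Icc (-1) (T - ε) ×ˢ Metric.closedBall x₀ (R + N)) :=
      isCompact_Icc.prod (isCompact_closedBall _ _)
    have hcs : HasCompactSupport (uncurry φ) := HasCompactSupport.of_support_subset_isCompact hK hsupp
    have hts : tsupport (uncurry φ) ⊆ Iio T ×ˢ univ := by
      refine (closure_minimal hsupp hK.isClosed).trans ?_
      rintro q ⟨h1, -⟩
      exact ⟨by have := h1.2; simp only [mem_Iio]; linarith, trivial⟩
    have h0 := hsub φ hcd hcs hts (fun t x => fsp_nonneg _ _ _ _ _ _ _ _)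
    have hM' : ∀ᵐ q : ℝ × EuclideanSpace ℝ (Fin d),
        q ∈ Ioo (0 : ℝ) T ×ˢ (univ : Set (EuclideanSpace ℝ (Fin d))) → |w q| ≤ M := by
      filter_upwards [hM] with q h hq using h hq.1
    have hV' : ∀ᵐ q : ℝ × EuclideanSpace ℝ (Fin d),
        q ∈ Ioo (0 : ℝ) T ×ˢ (univ : Set (EuclideanSpace ℝ (Fin d))) → ‖V q‖ ≤ N := by
      filter_upwards [hVbd] with q h hq using h hq.1
    have hint := fsp_integrable _ hS volume N C M hN.le hC w V hwmeas hVmeas hM' hV' _ hcd hcs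
    have heq : ∀ q, w q * deriv (fun s => φ s q.2) q.1 + w q * ⟪V q, gradient (φ q.1) q.2⟫
          + C * w q * φ q.1 q.2
        = w q * fderiv ℝ (uncurry φ) q (1, V q) + C * w q * uncurry φ q := by
      intro q
      rw [← fsp_deriv_formulas φ hcd q (V q)]
      simp only [uncurry]
      ring
    have hle : ∀ᵐ q ∂(volume.restrict (Ioo (0 : ℝ) T ×ˢ
        (univ : Set (EuclideanSpace ℝ (Fin d))))),
        w q * fderiv ℝ (uncurry φ) q (1, V q) + C * w q * uncurry φ q ≤ -(w q * φ q.1 q.2)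
          ∧ 0 ≤ w q * φ q.1 q.2 := by
      rw [ae_restrict_iff' hS]
      filter_upwards [hwnn, hVbd] with q h1 h2 hq
      have h1 := h1 hq.1
      have hp := fsp_pointwise (T - ε) N C R ε hN.le hε x₀ q.1 hq.1.1 q.2 (V q) (h2 hq.1)
      rw [← hφ] at hp
      refine ⟨?_, mul_nonneg h1 (fsp_nonneg _ _ _ _ _ _ _ _)⟩
      rw [← heq]
      have := mul_le_mul_of_nonneg_left hp h1
      linarith
    simp_rw [heq] at h0
    have hnn : 0 ≤ᵐ[volume.restrict (Ioo (0 : ℝ) T ×ˢ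
        (univ : Set (EuclideanSpace ℝ (Fin d))))]
        (fun q => -(w q * fderiv ℝ (uncurry φ) q (1, V q) + C * w q * uncurry φ q)) := by
      filter_upwards [hle] with q h
      simp only [Pi.zero_apply]
      linarith [h.1, h.2]
    have hz : ∫ q in (Ioo (0 : ℝ) T ×ˢ (univ : Set (EuclideanSpace ℝ (Fin d)))),
        -(w q * fderiv ℝ (uncurry φ) q (1, V q) + C * w q * uncurry φ q) = 0 := by
      apply le_antisymm
      · rw [integral_neg]; linarith
      · exact integral_nonneg_of_ae hnn
    rw [integral_eq_zero_iff_of_nonneg_ae hnn hint.neg] at hz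
    have hfin : ∀ᵐ q ∂(volume.restrict (Ioo (0 : ℝ) T ×ˢ
        (univ : Set (EuclideanSpace ℝ (Fin d))))), w q * φ q.1 q.2 = 0 := by
      filter_upwards [hz, hle] with q h1 h2
      simp only [Pi.zero_apply] at h1
      linarith [h2.1, h2.2]
    rw [ae_restrict_iff' hS] at hfin
    filter_upwards [hfin] with q h hq using h ⟨hq, trivial⟩
  filter_upwards [ae_all_iff.2 key] with q hq
  rintro ⟨ht, htT, hx⟩
  have htT' : q.1 < T := htT.trans_le (min_le_left _ _)
  have hlim : Tendsto (fun n : ℕ => 1 / ((n : ℝ) + 1)) atTop (nhds 0) :=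
    tendsto_one_div_add_atTop_nhds_zero_nat
  have e1 : ∀ᶠ n : ℕ in atTop, 1 / ((n : ℝ) + 1) < T - q.1 :=
    hlim.eventually_lt_const (by linarith)
  have e2 : ∀ᶠ n : ℕ in atTop,
      √((1 / ((n : ℝ) + 1)) ^ 2 + ‖q.2 - x₀‖ ^ 2) < R - N * q.1 := by
    have : Tendsto (fun n : ℕ => √((1 / ((n : ℝ) + 1)) ^ 2 + ‖q.2 - x₀‖ ^ 2)) atTop
        (nhds (√((0 : ℝ) ^ 2 + ‖q.2 - x₀‖ ^ 2))) :=
      ((hlim.pow 2).add_const _).sqrt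
    refine this.eventually_lt_const ?_
    rw [zero_pow two_ne_zero, zero_add, Real.sqrt_sq (norm_nonneg _)]
    exact hx
  obtain ⟨n, h1, h2⟩ := (e1.and e2).exists
  refine (mul_eq_zero.1 (hq n ⟨ht, htT'⟩)).resolve_right (ne_of_gt ?_)
  unfold fspPhi
  have p1 := Real.smoothTransition.pos_of_pos (x := q.1 + 1) (by linarith)
  have p2 := Real.smoothTransition.pos_of_pos (x := T - 1 / ((n : ℝ) + 1) - q.1) (by linarith)
  have p3 := Real.smoothTransition.pos_of_pos
    (x := R - N * q.1 - √((1 / ((n : ℝ) + 1)) ^ 2 + ‖q.2 - x₀‖ ^ 2)) (by linarith)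
  exact mul_pos (mul_pos p1 (mul_pos (Real.exp_pos _) p2)) p3
end
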